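/- Let p be a prime number and let A be an abelian group such that every element of A has order a power of p and the p-torsion subgroup A[p] is finite. Then the natural evaluation map Hom_ℤ(ℚ_p/ℤ_p, A) ⊗_ℤ (ℚ_p/ℤ_p) → A, sending φ ⊗ x to φ(x), is injective, and its image is exactly the maximal divisible subgroup of A. -/

import Mathlib

/-- The Prüfer `p`-group `ℚ_p/ℤ_p`: the quotient of the additive group of the `p`-adic
numbers by the additive subgroup given by the `p`-adic integers. -/
noncomputable def PadicQuotient (p : ℕ) [Fact p.Prime] : Type :=
  ℚ_[p] ⧸ (LinearMap.range (Algebra.linearMap ℤ_[p] ℚ_[p]))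

noncomputable instance (p : ℕ) [Fact p.Prime] : AddCommGroup (PadicQuotient p) :=
  inferInstanceAs (AddCommGroup (ℚ_[p] ⧸ (LinearMap.range (Algebra.linearMap ℤ_[p] ℚ_[p]))))

open scoped TensorProduct

/-- The natural evaluation map `Hom_ℤ(ℚ_p/ℤ_p, A) ⊗_ℤ (ℚ_p/ℤ_p) → A`, `φ ⊗ x ↦ φ x`. -/
noncomputable def evalMap (p : ℕ) [Fact p.Prime] (A : Type*) [AddCommGroup A] :
    ((PadicQuotient p →+ A) ⊗[ℤ] PadicQuotient p) →ₗ[ℤ] A :=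
  TensorProduct.lift
    { toFun := fun φ => φ.toIntLinearMap
      map_add' := fun φ ψ => rfl
      map_smul' := fun n φ => rfl }

/-- The maximal divisible subgroup of an abelian group `A`: the largest subgroup `D` of `A`
such that `n • D = D` for every positive integer `n`, i.e. the supremum of all divisible
subgroups of `A`. -/
def maximalDivisibleSubgroup (A : Type*) [AddCommGroup A] : AddSubgroup A :=
  sSup {D : AddSubgroup A | ∀ n : ℕ, 0 < n → ∀ a ∈ D, ∃ b ∈ D, n • b = a}

namespace PadicQuotient

variable (p : ℕ) [Fact p.Prime]

/-- The quotient map `ℚ_p → ℚ_p/ℤ_p`. -/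
noncomputable def mk : ℚ_[p] →+ PadicQuotient p :=
  (LinearMap.range (Algebra.linearMap ℤ_[p] ℚ_[p])).mkQ.toAddMonoidHom

theorem mk_surjective : Function.Surjective (mk p) :=
  Submodule.mkQ_surjective _

variable {p} in
theorem mk_eq_zero_iff {z : ℚ_[p]} : mk p z = 0 ↔ ‖z‖ ≤ 1 := by
  refine (Submodule.Quotient.mk_eq_zero (LinearMap.range (Algebra.linearMap ℤ_[p] ℚ_[p]))).trans
    ⟨?_, fun h => ⟨⟨z, h⟩, rfl⟩⟩
  rintro ⟨w, rfl⟩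
  exact w.2

/-- The class of `p⁻ⁿ` in `ℚ_p/ℤ_p`. -/
noncomputable def gen (n : ℕ) : PadicQuotient p :=
  mk p ((p : ℚ_[p]) ^ n)⁻¹

theorem prime_cast_ne_zero : (p : ℚ_[p]) ≠ 0 :=
  Nat.cast_ne_zero.mpr (Fact.out : p.Prime).ne_zero

theorem exists_nsmul_eq (n : ℕ) (hn : 0 < n) (x : PadicQuotient p) : ∃ y, n • y = x := by
  obtain ⟨z, rfl⟩ := mk_surjective p x
  have hn' : (n : ℚ_[p]) ≠ 0 := Nat.cast_ne_zero.mpr hn.ne'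
  refine ⟨mk p ((n : ℚ_[p])⁻¹ * z), ?_⟩
  rw [← map_nsmul, nsmul_eq_mul, mul_inv_cancel_left₀ hn']

theorem pow_nsmul_gen_add (n k : ℕ) : p ^ k • gen p (n + k) = gen p n := by
  have hp := prime_cast_ne_zero p
  rw [gen, gen, ← map_nsmul, nsmul_eq_mul]
  congr 1
  push_cast
  field_simp
  ring

theorem pow_nsmul_gen (n : ℕ) : p ^ n • gen p n = 0 := by
  have h := pow_nsmul_gen_add p 0 n
  rw [zero_add] at h
  rw [h, gen, mk_eq_zero_iff]
  simp

theorem pow_dvd_of_zsmul_gen_eq_zero {n : ℕ} {m : ℤ} (h : m • gen p n = 0) :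
    (p ^ n : ℤ) ∣ m := by
  rw [gen, ← map_zsmul, mk_eq_zero_iff, zsmul_eq_mul, norm_mul, norm_inv, Padic.norm_p_pow,
    zpow_neg, inv_inv, zpow_natCast] at h
  rw [← Padic.norm_int_le_pow_iff_dvd, zpow_neg, zpow_natCast]
  have hp : (0 : ℝ) < (p : ℝ) ^ n := pow_pos (mod_cast (Fact.out : p.Prime).pos) n
  rwa [← one_div, le_div_iff₀ hp]

theorem exists_eq_nsmul_gen {n : ℕ} {x : PadicQuotient p} (h : p ^ n • x = 0) :
    ∃ m : ℕ, x = m • gen p n := by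
  obtain ⟨z, rfl⟩ := mk_surjective p x
  rw [← map_nsmul, mk_eq_zero_iff, nsmul_eq_mul] at h
  obtain ⟨v, hv⟩ : ∃ v : ℤ_[p], (v : ℚ_[p]) = (p : ℚ_[p]) ^ n * z :=
    ⟨⟨_, h⟩, by push_cast; rfl⟩
  obtain ⟨w, hw⟩ := Ideal.mem_span_singleton'.mp (PadicInt.appr_spec n v)
  refine ⟨v.appr n, ?_⟩
  have hw' := congrArg ((↑) : ℤ_[p] → ℚ_[p]) hw
  push_cast at hw'
  have hp := prime_cast_ne_zero p
  rw [← sub_eq_zero, gen, ← map_nsmul, ← map_sub, mk_eq_zero_iff, nsmul_eq_mul]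
  convert w.2 using 2
  field_simp
  linear_combination -hw' - hv

theorem exists_pow_nsmul_eq_zero (x : PadicQuotient p) : ∃ n : ℕ, p ^ n • x = 0 := by
  obtain ⟨z, rfl⟩ := mk_surjective p x
  have hp : (1 : ℝ) < p := mod_cast (Fact.out : p.Prime).one_lt
  obtain ⟨n, hn⟩ := pow_unbounded_of_one_lt ‖z‖ hp
  refine ⟨n, ?_⟩
  rw [← map_nsmul, mk_eq_zero_iff, nsmul_eq_mul, Nat.cast_pow, norm_mul, Padic.norm_p_pow,
    zpow_neg, zpow_natCast]
  exact inv_mul_le_one_of_le₀ hn.le (by positivity)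

variable {p} {A : Type*} [AddCommGroup A]

theorem exists_eq_pow_nsmul_of_apply_gen_eq_zero {φ : PadicQuotient p →+ A} {n : ℕ}
    (h : φ (gen p n) = 0) : ∃ ψ : PadicQuotient p →+ A, φ = p ^ n • ψ := by
  have hsurj : Function.Surjective (nsmulAddMonoidHom (α := PadicQuotient p) (p ^ n)) :=
    exists_nsmul_eq p _ (pow_pos (Fact.out : p.Prime).pos n)
  have hker : (nsmulAddMonoidHom (α := PadicQuotient p) (p ^ n)).ker ≤ φ.ker := by
    intro x hx
    obtain ⟨m, rfl⟩ := exists_eq_nsmul_gen p hx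
    rw [AddMonoidHom.mem_ker, map_nsmul, h, smul_zero]
  refine ⟨AddMonoidHom.liftOfSurjective _ hsurj ⟨φ, hker⟩, AddMonoidHom.ext fun x => ?_⟩
  rw [AddMonoidHom.nsmul_apply, ← map_nsmul]
  exact (AddMonoidHom.liftOfRightInverse_comp_apply _ _ _ ⟨φ, hker⟩ x).symm

theorem exists_eq_tmul_gen (t : (PadicQuotient p →+ A) ⊗[ℤ] PadicQuotient p) :
    ∃ φ n, t = φ ⊗ₜ gen p n := by
  induction t with
  | zero => exact ⟨0, 0, (TensorProduct.zero_tmul _ _).symm⟩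
  | tmul φ x =>
    obtain ⟨n, hn⟩ := exists_pow_nsmul_eq_zero p x
    obtain ⟨m, rfl⟩ := exists_eq_nsmul_gen p hn
    exact ⟨m • φ, n, by rw [TensorProduct.smul_tmul]⟩
  | add s t hs ht =>
    obtain ⟨φ, n, rfl⟩ := hs
    obtain ⟨ψ, k, rfl⟩ := ht
    refine ⟨p ^ k • φ + p ^ n • ψ, n + k, ?_⟩
    rw [TensorProduct.add_tmul, TensorProduct.smul_tmul, TensorProduct.smul_tmul,
      pow_nsmul_gen_add, add_comm n k, pow_nsmul_gen_add]

/-- An element killed by `p ^ n` in a divisible group is the image of the class of `p⁻ⁿ` under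
some homomorphism from `ℚ_p/ℤ_p`. -/
theorem exists_apply_gen_eq (hA : ∀ n : ℕ, 0 < n → ∀ a : A, ∃ b : A, n • b = a)
    {a : A} {n : ℕ} (ha : p ^ n • a = 0) : ∃ φ : PadicQuotient p →+ A, φ (gen p n) = a := by
  have hdiv : ∀ {m : ℤ}, m ≠ 0 → Function.Surjective (fun b : A => m • b) := by
    intro m hm b
    obtain ⟨c, hc⟩ := hA m.natAbs (Int.natAbs_pos.mpr hm) b
    obtain h | h := Int.natAbs_eq m
    · exact ⟨c, by rw [← hc, ← natCast_zsmul, ← h]⟩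
    · refine ⟨-c, ?_⟩
      dsimp only
      rw [← hc, ← natCast_zsmul, smul_neg, ← neg_smul]
      congr 1
      omega
  let _ : DivisibleBy A ℤ := divisibleByOfSMulRightSurj A ℤ hdiv
  let f : {f : ℤ →+ PadicQuotient p // f (p ^ n : ℕ) = 0} :=
    ⟨zmultiplesHom _ (gen p n), (natCast_zsmul _ _).trans (pow_nsmul_gen p n)⟩
  let g : {g : ℤ →+ A // g (p ^ n : ℕ) = 0} := ⟨zmultiplesHom _ a, (natCast_zsmul _ _).trans ha⟩
  have hf : Function.Injective (ZMod.lift (p ^ n) f) := by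
    refine (ZMod.lift_injective _).mpr fun m hm => ?_
    rw [ZMod.intCast_zmod_eq_zero_iff_dvd]
    exact_mod_cast pow_dvd_of_zsmul_gen_eq_zero p hm
  obtain ⟨φ, hφ⟩ := (Module.Baer.of_divisible A).extension_property_addMonoidHom _ hf
    (ZMod.lift (p ^ n) g)
  refine ⟨φ, ?_⟩
  have h := DFunLike.congr_fun hφ ((1 : ℤ) : ZMod (p ^ n))
  rw [AddMonoidHom.comp_apply, ZMod.lift_coe, ZMod.lift_coe] at h
  simpa [f, g] using h

end PadicQuotient

open PadicQuotient in
theorem evalMap_injective (p : ℕ) [Fact p.Prime] (A : Type*) [AddCommGroup A] :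
    Function.Injective (evalMap p A) := by
  refine (injective_iff_map_eq_zero _).mpr fun t ht => ?_
  obtain ⟨φ, n, rfl⟩ := exists_eq_tmul_gen t
  obtain ⟨ψ, rfl⟩ := exists_eq_pow_nsmul_of_apply_gen_eq_zero (φ := φ) (n := n) ht
  rw [TensorProduct.smul_tmul, pow_nsmul_gen, TensorProduct.tmul_zero]

open PadicQuotient in
theorem range_evalMap (p : ℕ) [Fact p.Prime] (A : Type*) [AddCommGroup A]
    (horder : ∀ a : A, ∃ n : ℕ, p ^ n • a = 0) :
    (evalMap p A).toAddMonoidHom.range = maximalDivisibleSubgroup A := by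
  apply le_antisymm
  · refine le_sSup ?_
    rintro n hn _ ⟨t, rfl⟩
    obtain ⟨φ, k, rfl⟩ := exists_eq_tmul_gen t
    obtain ⟨y, hy⟩ := exists_nsmul_eq p n hn (gen p k)
    refine ⟨_, ⟨φ ⊗ₜ y, rfl⟩, ?_⟩
    rw [← map_nsmul, ← TensorProduct.tmul_smul, hy]
  · refine sSup_le fun D hD a ha => ?_
    obtain ⟨n, hn⟩ := horder a
    have hD' : ∀ n : ℕ, 0 < n → ∀ a : D, ∃ b : D, n • b = a := fun n hn a =>
      have ⟨b, hb, h⟩ := hD n hn a a.2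
      ⟨⟨b, hb⟩, Subtype.ext h⟩
    obtain ⟨φ, hφ⟩ := exists_apply_gen_eq (p := p) hD' (a := ⟨a, ha⟩) (n := n) (Subtype.ext hn)
    exact ⟨(D.subtype.comp φ) ⊗ₜ gen p n, congrArg Subtype.val hφ⟩

/-- if `A` is a `p`-primary abelian group with finite `p`-torsion subgroup `A[p]`,
then the evaluation map `Hom_ℤ(ℚ_p/ℤ_p, A) ⊗_ℤ (ℚ_p/ℤ_p) → A` is injective with image
exactly the maximal divisible subgroup of `A`. -/
theorem statement3 (p : ℕ) [Fact p.Prime] (A : Type*) [AddCommGroup A]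
    (horder : ∀ a : A, ∃ n : ℕ, p ^ n • a = 0)
    (hfin : {a : A | p • a = 0}.Finite) :
    Function.Injective (evalMap p A) ∧
      Set.range (evalMap p A) = (maximalDivisibleSubgroup A : Set A) := by
  exact ⟨evalMap_injective p A, congrArg SetLike.coe (range_evalMap p A horder)⟩
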